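/- Almost surely, the sample paths t ↦ B_t(ω) of a standard Brownian motion are nowhere Lipschitz continuous on [0,1], and hence nowhere differentiable. -/

import Mathlib

open MeasureTheory ProbabilityTheory Filter
open scoped ENNReal Topology

/-- A standard (one-dimensional) Brownian motion: `B 0 = 0`, continuous paths,
independent increments, and Gaussian increments `B t - B s ~ N(0, t - s)`. -/
structure IsStandardBrownianMotion {Ω : Type*} [MeasurableSpace Ω]
    (μ : MeasureTheory.Measure Ω) (B : ℝ → Ω → ℝ) : Prop where
  zero : ∀ ω, B 0 ω = 0
  cont : ∀ ω, Continuous fun t => B t ω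
  indep : ∀ s t : ℝ, 0 ≤ s → s < t →
    ProbabilityTheory.Indep
      (MeasurableSpace.comap (fun ω => B t ω - B s ω) inferInstance)
      (⨆ u ∈ Set.Icc (0 : ℝ) s,
        MeasurableSpace.comap (fun ω => B u ω) inferInstance) μ
  gauss : ∀ s t : ℝ, 0 ≤ s → s < t →
    MeasureTheory.Measure.map (fun ω => B t ω - B s ω) μ =
      ProbabilityTheory.gaussianReal 0 (Real.toNNReal (t - s))

theorem ProbabilityTheory.gaussianReal_Icc_le {v : NNReal} (hv : v ≠ 0) (m a : ℝ) :
    gaussianReal m v (Set.Icc (-a) a) ≤ ENNReal.ofReal (2 * a / √v) := by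
  have hv' : (0 : ℝ) < v := by positivity
  have hpdf (x : ℝ) : gaussianPDF m v x ≤ ENNReal.ofReal ((√v)⁻¹) := by
    refine ENNReal.ofReal_le_ofReal ?_
    rw [gaussianPDFReal]
    have hexp : Real.exp (-(x - m) ^ 2 / (2 * v)) ≤ 1 :=
      Real.exp_le_one_iff.2 (div_nonpos_of_nonpos_of_nonneg (by nlinarith [sq_nonneg (x - m)])
        (by positivity))
    have hsqrt : (√(2 * Real.pi * v))⁻¹ ≤ (√v)⁻¹ := by
      gcongr
      nlinarith [Real.pi_gt_three]
    calc _ ≤ (√v)⁻¹ * 1 := by gcongr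
      _ = _ := mul_one _
  rw [gaussianReal_apply m hv]
  calc ∫⁻ x in Set.Icc (-a) a, gaussianPDF m v x
      ≤ ∫⁻ _ in Set.Icc (-a) a, ENNReal.ofReal ((√v)⁻¹) := lintegral_mono hpdf
    _ = ENNReal.ofReal (2 * a / √v) := by
      rw [setLIntegral_const, Real.volume_Icc, ← ENNReal.ofReal_mul (by positivity)]
      congr 1
      ring

theorem Real.abs_sub_le_of_abs_sub_le_mul {f : ℝ → ℝ} {S : Set ℝ} {s t u C δ r : ℝ}
    (hf : ∀ t ∈ S, |t - s| ≤ δ → |f t - f s| ≤ C * |t - s|) (hC : 0 ≤ C) (hr : r ≤ δ)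
    (ht : t ∈ S) (hu : u ∈ S) (hts : |t - s| ≤ r) (hus : |u - s| ≤ r) :
    |f t - f u| ≤ 2 * C * r := by
  have h₁ := hf t ht (hts.trans hr)
  have h₂ := hf u hu (hus.trans hr)
  have h₃ := mul_le_mul_of_nonneg_left hts hC
  have h₄ := mul_le_mul_of_nonneg_left hus hC
  have h₅ := abs_sub_le (f t) (f s) (f u)
  rw [abs_sub_comm (f s)] at h₅
  linarith

theorem exists_nat_three_consecutive_near {n : ℕ} (hn : 3 ≤ n) {s : ℝ}
    (hs : s ∈ Set.Icc (0 : ℝ) 1) :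
    ∃ k < n, ∀ i ≤ 3, ((k + i : ℕ) : ℝ) / n ∈ Set.Icc (0 : ℝ) 1 ∧
      |((k + i : ℕ) : ℝ) / n - s| ≤ 3 / n := by
  have hn0 : (0 : ℝ) < n := by positivity
  obtain ⟨hs0, hs1⟩ := hs
  have hfloor := Nat.floor_le (mul_nonneg hs0 hn0.le)
  have hlt := Nat.lt_floor_add_one (s * n)
  have hsn : s * n ≤ n := by nlinarith
  obtain ⟨k, hkn, hlo, hhi⟩ : ∃ k : ℕ, k + 3 ≤ n ∧ (k : ℝ) ≤ s * n ∧ s * n ≤ k + 3 := by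
    by_cases h : ⌊s * n⌋₊ + 3 ≤ n
    · exact ⟨_, h, hfloor, by linarith⟩
    · refine ⟨n - 3, by omega, ?_, ?_⟩
      · refine le_trans ?_ hfloor
        exact_mod_cast (by omega : n - 3 ≤ ⌊s * n⌋₊)
      · rw [Nat.cast_sub hn]
        push_cast
        linarith
  refine ⟨k, by omega, fun i hi => ⟨⟨by positivity, ?_⟩, ?_⟩⟩
  · rw [div_le_one hn0]
    exact_mod_cast (by omega : k + i ≤ n)
  · have hi' : (i : ℝ) ≤ 3 := by exact_mod_cast hi
    have hi0 : (0 : ℝ) ≤ i := by positivity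
    rw [div_sub' hn0.ne', abs_div, abs_of_pos hn0]
    gcongr
    rw [abs_le]
    push_cast
    constructor <;> linarith

theorem DifferentiableWithinAt.exists_abs_sub_le {f : ℝ → ℝ} {S : Set ℝ} {s : ℝ}
    (hf : DifferentiableWithinAt ℝ f S s) :
    ∃ C > (0 : ℝ), ∃ δ > (0 : ℝ), ∀ t ∈ S, |t - s| ≤ δ → |f t - f s| ≤ C * |t - s| := by
  obtain ⟨C, hC, hO⟩ := hf.hasFDerivWithinAt.isBigO_sub.exists_pos
  obtain ⟨ε, hε, hball⟩ := Metric.mem_nhdsWithin_iff.1 hO.bound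
  refine ⟨C, hC, ε / 2, by positivity, fun t ht hts => hball ⟨?_, ht⟩⟩
  rw [Metric.mem_ball, Real.dist_eq]
  linarith

namespace IsStandardBrownianMotion

variable {Ω : Type*} {B : ℝ → Ω → ℝ}

theorem measurableSet_abs_sub_le {r s t : ℝ} (hs : s ∈ Set.Icc 0 r)
    (ht : t ∈ Set.Icc 0 r) (a : ℝ) :
    MeasurableSet[⨆ u ∈ Set.Icc (0 : ℝ) r, MeasurableSpace.comap (fun ω => B u ω) inferInstance]
      {ω | |B t ω - B s ω| ≤ a} := by
  have hmeas {u : ℝ} (hu : u ∈ Set.Icc 0 r) :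
      Measurable[⨆ u ∈ Set.Icc (0 : ℝ) r, MeasurableSpace.comap (fun ω => B u ω) inferInstance]
        (B u) :=
    Measurable.mono (comap_measurable (B u))
      (le_iSup₂ (f := fun u (_ : u ∈ Set.Icc (0 : ℝ) r) =>
        MeasurableSpace.comap (fun ω => B u ω) inferInstance) u hu) le_rfl
  have hsub := @Measurable.sub _ _ _ _ _ (_) _ _ (hmeas ht) (hmeas hs)
  have hIcc := hsub (measurableSet_Icc (a := -a) (b := a))
  convert hIcc using 1
  ext ω
  simp [abs_le]

/-- The paths having three consecutive increments of size at most `a` along the grid of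
mesh `1 / n`, the first of them starting before time `1`. -/
def smallIncrements (B : ℝ → Ω → ℝ) (n : ℕ) (a : ℝ) : Set Ω :=
  ⋃ k ∈ Finset.range n, {ω | ∀ i < 3,
    |B (((k + (i + 1) : ℕ) : ℝ) / n) ω - B (((k + i : ℕ) : ℝ) / n) ω| ≤ a}

theorem mem_smallIncrements_of_abs_sub_le {ω : Ω} {n : ℕ} {s C c δ : ℝ}
    (hs : s ∈ Set.Icc (0 : ℝ) 1) (hC : 0 ≤ C) (hc : 6 * C ≤ c)
    (hf : ∀ t ∈ Set.Icc (0 : ℝ) 1, |t - s| ≤ δ → |B t ω - B s ω| ≤ C * |t - s|)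
    (hn : 3 ≤ n) (hδ : 3 / n ≤ δ) :
    ω ∈ smallIncrements B n (c / n) := by
  obtain ⟨k, hk, hgrid⟩ := exists_nat_three_consecutive_near hn hs
  refine Set.mem_biUnion (Finset.mem_range.2 hk) fun i hi => ?_
  obtain ⟨hu, hus⟩ := hgrid i (by omega)
  obtain ⟨ht, hts⟩ := hgrid (i + 1) (by omega)
  calc _ ≤ 2 * C * (3 / n) :=
      Real.abs_sub_le_of_abs_sub_le_mul (f := fun t => B t ω) hf hC hδ ht hu hts hus
    _ = 6 * C / n := by ring
    _ ≤ c / n := by gcongr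

variable [MeasurableSpace Ω] {μ : Measure Ω}

theorem measure_abs_sub_le (hB : IsStandardBrownianMotion μ B) {s t : ℝ} (hs : 0 ≤ s)
    (hst : s < t) (a : ℝ) :
    μ {ω | |B t ω - B s ω| ≤ a} ≤ ENNReal.ofReal (2 * a / √(t - s)) := by
  have hmap := hB.gauss s t hs hst
  have hmeas : AEMeasurable (fun ω => B t ω - B s ω) μ := by
    refine AEMeasurable.of_map_ne_zero ?_
    rw [hmap]
    exact IsProbabilityMeasure.ne_zero _
  have hset : {ω | |B t ω - B s ω| ≤ a} = (fun ω => B t ω - B s ω) ⁻¹' Set.Icc (-a) a := by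
    ext ω
    simp [abs_le]
  rw [hset, ← Measure.map_apply_of_aemeasurable hmeas measurableSet_Icc, hmap]
  have hv : Real.toNNReal (t - s) ≠ 0 := (Real.toNNReal_pos.2 (sub_pos.2 hst)).ne'
  have h := gaussianReal_Icc_le hv 0 a
  rwa [Real.coe_toNNReal _ (sub_pos.2 hst).le] at h

theorem measure_inter_abs_sub_le (hB : IsStandardBrownianMotion μ B) {s t : ℝ} (hs : 0 ≤ s)
    (hst : s < t) (a : ℝ) {A : Set Ω}
    (hA : MeasurableSet[⨆ u ∈ Set.Icc (0 : ℝ) s,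
      MeasurableSpace.comap (fun ω => B u ω) inferInstance] A) :
    μ ({ω | |B t ω - B s ω| ≤ a} ∩ A) ≤ ENNReal.ofReal (2 * a / √(t - s)) * μ A := by
  have hE : MeasurableSet[MeasurableSpace.comap (fun ω => B t ω - B s ω) inferInstance]
      {ω | |B t ω - B s ω| ≤ a} := by
    refine ⟨Set.Icc (-a) a, measurableSet_Icc, ?_⟩
    ext ω
    simp [abs_le]
  rw [(Indep_iff _ _ _).1 (hB.indep s t hs hst) _ _ hE hA]
  gcongr
  exact hB.measure_abs_sub_le hs hst a

theorem measure_three_increments_le (hB : IsStandardBrownianMotion μ B) {s h : ℝ} (hs : 0 ≤ s)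
    (hh : 0 < h) (a : ℝ) :
    μ ({ω | |B (s + 3 * h) ω - B (s + 2 * h) ω| ≤ a} ∩
      ({ω | |B (s + 2 * h) ω - B (s + h) ω| ≤ a} ∩ {ω | |B (s + h) ω - B s ω| ≤ a})) ≤
      ENNReal.ofReal (2 * a / √h) ^ 3 := by
  have h₀ := hB.measure_abs_sub_le hs (by linarith : s < s + h) a
  have h₁ := hB.measure_inter_abs_sub_le (by linarith) (by linarith : s + h < s + 2 * h) a
    (measurableSet_abs_sub_le (B := B) (s := s) (t := s + h)
      ⟨hs, by linarith⟩ ⟨by linarith, le_rfl⟩ a)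
  have hA : MeasurableSet[⨆ u ∈ Set.Icc (0 : ℝ) (s + 2 * h),
      MeasurableSpace.comap (fun ω => B u ω) inferInstance]
      ({ω | |B (s + 2 * h) ω - B (s + h) ω| ≤ a} ∩ {ω | |B (s + h) ω - B s ω| ≤ a}) :=
    MeasurableSet.inter
      (measurableSet_abs_sub_le ⟨by linarith, by linarith⟩ ⟨by linarith, by linarith⟩ a)
      (measurableSet_abs_sub_le ⟨by linarith, by linarith⟩ ⟨by linarith, by linarith⟩ a)
  have h₂ := hB.measure_inter_abs_sub_le (by linarith)
    (by linarith : s + 2 * h < s + 3 * h) a hA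
  rw [show s + h - s = h by ring] at h₀
  rw [show s + 2 * h - (s + h) = h by ring] at h₁
  rw [show s + 3 * h - (s + 2 * h) = h by ring] at h₂
  calc _ ≤ _ := h₂
    _ ≤ ENNReal.ofReal (2 * a / √h) * (ENNReal.ofReal (2 * a / √h) *
        ENNReal.ofReal (2 * a / √h)) := by
      gcongr
      exact h₁.trans (by gcongr)
    _ = _ := by ring

theorem measure_smallIncrements_le (hB : IsStandardBrownianMotion μ B) {n : ℕ} (hn : 0 < n)
    {c : ℝ} (hc : 0 ≤ c) :
    μ (smallIncrements B n (c / n)) ≤ ENNReal.ofReal ((2 * c) ^ 3 / √n) := by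
  have hn0 : (0 : ℝ) < n := by exact_mod_cast hn
  have hterm (k : ℕ) : μ {ω | ∀ i < 3,
      |B (((k + (i + 1) : ℕ) : ℝ) / n) ω - B (((k + i : ℕ) : ℝ) / n) ω| ≤ c / n} ≤
      ENNReal.ofReal (2 * (c / n) / √(1 / n)) ^ 3 := by
    refine (measure_mono fun ω hω => ?_).trans
      (hB.measure_three_increments_le (s := k / n) (h := 1 / n) (by positivity) (by positivity)
        (c / n))
    have hgrid (i : ℕ) : ((k + i : ℕ) : ℝ) / n = k / n + i * (1 / n) := by
      push_cast
      ring
    simp only [Set.mem_ofPred_eq, hgrid] at hω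
    have h₀ := hω 0 (by norm_num)
    have h₁ := hω 1 (by norm_num)
    have h₂ := hω 2 (by norm_num)
    norm_num at h₀ h₁ h₂
    refine ⟨?_, ?_, ?_⟩ <;> simpa
  have hsq : √(n : ℝ) ^ 2 = n := Real.sq_sqrt hn0.le
  have hpos : 0 < √(n : ℝ) := Real.sqrt_pos.2 hn0
  calc μ (smallIncrements B n (c / n))
      ≤ ∑ k ∈ Finset.range n, _ := measure_biUnion_finset_le _ _
    _ ≤ ∑ _k ∈ Finset.range n, ENNReal.ofReal (2 * (c / n) / √(1 / n)) ^ 3 :=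
      Finset.sum_le_sum fun k _ => hterm k
    _ = ENNReal.ofReal ((2 * c) ^ 3 / √n) := by
      rw [Finset.sum_const, Finset.card_range, nsmul_eq_mul, ← ENNReal.ofReal_pow (by positivity),
        ← ENNReal.ofReal_natCast, ← ENNReal.ofReal_mul hn0.le]
      congr 1
      rw [one_div, Real.sqrt_inv]
      generalize √(n : ℝ) = r at *
      rw [← hsq]
      field_simp

theorem ae_frequently_notMem_smallIncrements (hB : IsStandardBrownianMotion μ B) {c : ℝ}
    (hc : 0 ≤ c) : ∀ᵐ ω ∂μ, ∃ᶠ n : ℕ in atTop, ω ∉ smallIncrements B n (c / n) := by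
  have hlim : Tendsto (fun n : ℕ => ENNReal.ofReal ((2 * c) ^ 3 / √n)) atTop (𝓝 0) := by
    rw [← ENNReal.ofReal_zero]
    exact ENNReal.tendsto_ofReal <| tendsto_const_nhds.div_atTop <|
      Real.tendsto_sqrt_atTop.comp tendsto_natCast_atTop_atTop
  have hnull (N : ℕ) : μ (⋂ n ≥ N, smallIncrements B n (c / n)) = 0 := by
    refine le_antisymm (ge_of_tendsto hlim ?_) zero_le
    filter_upwards [eventually_ge_atTop N, eventually_gt_atTop 0] with n hnN hn
    exact (measure_mono (Set.biInter_subset_of_mem hnN)).trans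
      (hB.measure_smallIncrements_le hn hc)
  filter_upwards [ae_all_iff.2 fun N => measure_eq_zero_iff_ae_notMem.1 (hnull N)] with ω hω
  rw [frequently_atTop]
  intro N
  simpa using hω N

end IsStandardBrownianMotion

/-- Almost surely, the sample paths of a standard Brownian motion are nowhere Lipschitz
continuous on `[0,1]`, and hence nowhere differentiable there. -/
theorem brownian_paths_nowhere_lipschitz
    {Ω : Type*} [MeasurableSpace Ω] {μ : Measure Ω} [IsProbabilityMeasure μ]
    {B : ℝ → Ω → ℝ} (hB : IsStandardBrownianMotion μ B) :
    ∀ᵐ ω ∂μ, ∀ s ∈ Set.Icc (0 : ℝ) 1,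
      (¬ ∃ C > (0 : ℝ), ∃ δ > (0 : ℝ), ∀ t ∈ Set.Icc (0 : ℝ) 1,
        |t - s| ≤ δ → |B t ω - B s ω| ≤ C * |t - s|) ∧
      ¬ DifferentiableWithinAt ℝ (fun t => B t ω) (Set.Icc (0 : ℝ) 1) s := by
  filter_upwards [ae_all_iff.2 fun m : ℕ =>
    hB.ae_frequently_notMem_smallIncrements (Nat.cast_nonneg m)] with ω hω s hs
  have hnot : ¬ ∃ C > (0 : ℝ), ∃ δ > (0 : ℝ), ∀ t ∈ Set.Icc (0 : ℝ) 1,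
      |t - s| ≤ δ → |B t ω - B s ω| ≤ C * |t - s| := by
    rintro ⟨C, hC, δ, hδ, hf⟩
    obtain ⟨m, hm⟩ := exists_nat_ge (6 * C)
    have hsmall : ∀ᶠ n : ℕ in atTop, 3 / (n : ℝ) ≤ δ :=
      (tendsto_const_div_atTop_nhds_zero_nat 3).eventually_le_const hδ
    refine hω m ?_
    filter_upwards [hsmall, eventually_ge_atTop 3] with n hnδ hn
    exact not_not.2 (IsStandardBrownianMotion.mem_smallIncrements_of_abs_sub_le
      hs hC.le hm hf hn hnδ)
  exact ⟨hnot, fun hd => hnot hd.exists_abs_sub_le⟩
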